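/- arXiv:1704.03555 — 2 statements merged into one kernel-verified Lean document; each statement's English description precedes it below -/
import Mathlib

section
/- Consider the linear system f(x, u) = A x + B u with A ∈ ℝ^{n×n} invertible and B ∈ ℝ^{n×m}. If 𝒰 ⊆ ℝ^m, 𝒦 ⊆ ℝⁿ, and 𝒯 ⊆ ℝⁿ are convex and compact sets, and 𝒟 ⊆ ℝⁿ is a nonempty compact set, then for every k ∈ ℕ the robust reach-avoid set RA_k(𝒯, 𝒦, 𝒟) is convex and compact. -/
/-- Closed-loop trajectory of the perturbed system `x_{k+1} = f(x_k, ν_k(x_k)) + w_k`. -/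
def traj {n m : ℕ} (f : (Fin n → ℝ) → (Fin m → ℝ) → (Fin n → ℝ))
    (ν : ℕ → (Fin n → ℝ) → (Fin m → ℝ)) (w : ℕ → (Fin n → ℝ)) (x0 : Fin n → ℝ) :
    ℕ → (Fin n → ℝ)
  | 0 => x0
  | k + 1 => f (traj f ν w x0 k) (ν k (traj f ν w x0 k)) + w k

/-- The `t`-step robust reach-avoid set `RA_t(𝒯, 𝒦, 𝒟)`. -/
def RA {n m : ℕ} (f : (Fin n → ℝ) → (Fin m → ℝ) → (Fin n → ℝ)) (U : Set (Fin m → ℝ))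
    (T K D : Set (Fin n → ℝ)) (t : ℕ) : Set (Fin n → ℝ) :=
  {x0 | ∃ ν : ℕ → (Fin n → ℝ) → (Fin m → ℝ),
    (∀ k, k < t → ∀ x, ν k x ∈ U) ∧
    ∀ w : ℕ → (Fin n → ℝ), (∀ k, k < t → w k ∈ D) →
      (∀ k, k < t → traj f ν w x0 k ∈ K) ∧ traj f ν w x0 t ∈ T}

/-- States of `K` from which some input in `U` steers the system into `S` for every
disturbance in `D`. -/
def robustPre {n m : ℕ} (f : (Fin n → ℝ) → (Fin m → ℝ) → (Fin n → ℝ)) (U : Set (Fin m → ℝ))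
    (K D S : Set (Fin n → ℝ)) : Set (Fin n → ℝ) :=
  {x | x ∈ K ∧ ∃ u ∈ U, ∀ d ∈ D, f x u + d ∈ S}

section General

variable {n m : ℕ} {f : (Fin n → ℝ) → (Fin m → ℝ) → (Fin n → ℝ)} {U : Set (Fin m → ℝ)}
  {T K D : Set (Fin n → ℝ)}

theorem robustPre_mono : Monotone (robustPre f U K D) := by
  rintro S S' h x ⟨hx, u, hu, hd⟩
  exact ⟨hx, u, hu, fun d hdD => h (hd d hdD)⟩

theorem traj_shift (ν : ℕ → (Fin n → ℝ) → (Fin m → ℝ)) (w : ℕ → (Fin n → ℝ))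
    (x : Fin n → ℝ) (j : ℕ) :
    traj f ν w x (j + 1) =
      traj f (fun i => ν (i + 1)) (fun i => w (i + 1)) (f x (ν 0 x) + w 0) j := by
  induction j with
  | zero => rfl
  | succ j ih => rw [traj, ih]; rfl

theorem RA_zero : RA f U T K D 0 = T := by
  ext x
  simp [RA, traj]

theorem RA_succ_subset (hD : D.Nonempty) (t : ℕ) :
    RA f U T K D (t + 1) ⊆ robustPre f U K D (RA f U T K D t) := by
  rintro x ⟨ν, hν, h⟩
  obtain ⟨d₀, hd₀⟩ := hD
  refine ⟨(h (fun _ => d₀) fun _ _ => hd₀).1 0 t.succ_pos, ν 0 x, hν 0 t.succ_pos x,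
    fun d hd => ⟨fun i => ν (i + 1), fun i hi => hν (i + 1) (Nat.succ_lt_succ hi),
      fun w hw => ?_⟩⟩
  let w' : ℕ → (Fin n → ℝ) := fun i => Nat.casesOn i d w
  have hw' : ∀ k, k < t + 1 → w' k ∈ D := by
    rintro (_ | k) hk
    · exact hd
    · exact hw k (Nat.lt_of_succ_lt_succ hk)
  obtain ⟨hK, hT⟩ := h w' hw'
  have key (j : ℕ) := traj_shift (f := f) ν w' x j
  refine ⟨fun j hj => ?_, ?_⟩
  · exact key j ▸ hK (j + 1) (Nat.succ_lt_succ hj)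
  · exact key t ▸ hT

theorem RA_subset_iterate (hD : D.Nonempty) (t : ℕ) :
    RA f U T K D t ⊆ (robustPre f U K D)^[t] T := by
  induction t with
  | zero => exact RA_zero.subset
  | succ t ih =>
    rw [Function.iterate_succ_apply']
    exact (RA_succ_subset hD t).trans (robustPre_mono ih)

theorem iterate_subset_RA (t : ℕ) : (robustPre f U K D)^[t] T ⊆ RA f U T K D t := by
  classical
  intro x hx
  rcases U.eq_empty_or_nonempty with hU | ⟨u₀, hu₀⟩
  · cases t with
    | zero => exact RA_zero.superset hx
    | succ t =>
      rw [Function.iterate_succ_apply'] at hx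
      obtain ⟨-, u, hu, -⟩ := hx
      simp [hU] at hu
  have hex : ∀ (s : ℕ) (y : Fin n → ℝ), ∃ u ∈ U, y ∈ (robustPre f U K D)^[s + 1] T →
      ∀ d ∈ D, f y u + d ∈ (robustPre f U K D)^[s] T := by
    intro s y
    by_cases hy : y ∈ (robustPre f U K D)^[s + 1] T
    · have hy' := hy
      rw [Function.iterate_succ_apply'] at hy'
      obtain ⟨-, u, hu, h⟩ := hy'
      exact ⟨u, hu, fun _ => h⟩
    · exact ⟨u₀, hu₀, fun h => absurd h hy⟩
  choose g hgU hg using hex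
  refine ⟨fun j => g (t - 1 - j), fun k _ y => hgU _ y, fun w hw => ?_⟩
  have inv : ∀ j ≤ t, traj f (fun j => g (t - 1 - j)) w x j ∈
      (robustPre f U K D)^[t - j] T := by
    intro j
    induction j with
    | zero => exact fun _ => hx
    | succ j ih =>
      intro hj
      have h := ih (by lia)
      rw [show t - j = t - 1 - j + 1 by lia] at h
      rw [show t - (j + 1) = t - 1 - j by lia]
      exact hg _ _ h _ (hw j hj)
  refine ⟨fun k hk => ?_, by simpa using inv t le_rfl⟩
  have h := inv k hk.le
  rw [show t - k = t - 1 - k + 1 by lia, Function.iterate_succ_apply'] at h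
  exact h.1

theorem RA_eq_iterate (hD : D.Nonempty) (t : ℕ) :
    RA f U T K D t = (robustPre f U K D)^[t] T :=
  (RA_subset_iterate hD t).antisymm (iterate_subset_RA t)

theorem isCompact_robustPre (hf : Continuous fun p : (Fin n → ℝ) × (Fin m → ℝ) => f p.1 p.2)
    (hU : IsCompact U) (hK : IsCompact K) {S : Set (Fin n → ℝ)} (hS : IsClosed S) :
    IsCompact (robustPre f U K D S) := by
  have hcl : IsClosed {p : (Fin n → ℝ) × (Fin m → ℝ) | ∀ d ∈ D, f p.1 p.2 + d ∈ S} := by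
    simp only [Set.ofPred_forall]
    exact isClosed_biInter fun d _ => hS.preimage (hf.add continuous_const)
  convert ((hK.prod hU).inter_right hcl).image continuous_fst using 1
  ext x
  simp [robustPre, and_assoc]

end General

theorem convex_robustPre_linear {n m : ℕ} (A : Matrix (Fin n) (Fin n) ℝ)
    (B : Matrix (Fin n) (Fin m) ℝ) {U : Set (Fin m → ℝ)} {K D S : Set (Fin n → ℝ)}
    (hU : Convex ℝ U) (hK : Convex ℝ K) (hS : Convex ℝ S) :
    Convex ℝ (robustPre (fun x u => A.mulVec x + B.mulVec u) U K D S) := by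
  rintro x ⟨hx, u, hu, hxu⟩ y ⟨hy, v, hv, hyv⟩ a b ha hb hab
  refine ⟨hK hx hy ha hb hab, a • u + b • v, hU hu hv ha hb hab, fun d hd => ?_⟩
  convert hS (hxu d hd) (hyv d hd) ha hb hab using 1
  simp only [Matrix.mulVec_add, Matrix.mulVec_smul, smul_add]
  nth_rewrite 1 [← one_smul ℝ d]
  rw [← hab, add_smul]
  abel

/-- for the linear system `f(x,u) = Ax + Bu` with `A` invertible, if
`𝒰, 𝒦, 𝒯` are convex and compact and `𝒟` is nonempty and compact, then every robust
reach-avoid set `RA_k(𝒯, 𝒦, 𝒟)` is convex and compact. -/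
theorem robust_reach_avoid_convex_compact {n m : ℕ}
    (A : Matrix (Fin n) (Fin n) ℝ) (B : Matrix (Fin n) (Fin m) ℝ) (hA : IsUnit A.det)
    (U : Set (Fin m → ℝ)) (T K D : Set (Fin n → ℝ))
    (hUc : Convex ℝ U) (hUcpt : IsCompact U)
    (hKc : Convex ℝ K) (hKcpt : IsCompact K)
    (hTc : Convex ℝ T) (hTcpt : IsCompact T)
    (hD : D.Nonempty) (hDcpt : IsCompact D) :
    ∀ k : ℕ, Convex ℝ (RA (fun x u => A.mulVec x + B.mulVec u) U T K D k) ∧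
      IsCompact (RA (fun x u => A.mulVec x + B.mulVec u) U T K D k) := by
  intro k
  rw [RA_eq_iterate hD]
  induction k with
  | zero => exact ⟨hTc, hTcpt⟩
  | succ k ih =>
    rw [Function.iterate_succ_apply']
    exact ⟨convex_robustPre_linear A B hUc hKc ih.1,
      isCompact_robustPre (by fun_prop) hUcpt hKcpt ih.2.isClosed⟩
end

section
/- Suppose 𝒦 ⊆ ℝⁿ and 𝒯 ⊆ ℝⁿ are Borel sets, 𝒰 ⊆ ℝ^m is nonempty, f : ℝⁿ × ℝ^m → ℝⁿ is Borel measurable, and each value function V_k (k ∈ {0, …, N}) is Borel measurable. Let β ∈ [0,1], let t ∈ {1, …, N}, and let 𝒟 ⊆ ℝⁿ be a nonempty Borel set with P(𝒟) = β^{1/t}. Then the t-step robust reach-avoid set underapproximates the stochastic reach-avoid β-level-set: RA_t(𝒯, 𝒦, 𝒟) ⊆ { x ∈ ℝⁿ : V_{N−t}(x) ≥ β }. -/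
open MeasureTheory

/-- Stochastic reach-avoid value functions, indexed by the number of remaining steps:
`Vstep 0 = 1_𝒯` and `Vstep (j+1) x = 1_𝒦(x) · sup_{u ∈ 𝒰} ∫ Vstep j (f(x,u) + w) dP(w)`.
The value function `V_k` of the horizon-`N` problem is `Vstep (N - k)`. -/
noncomputable def Vstep {n m : ℕ} (f : (Fin n → ℝ) → (Fin m → ℝ) → (Fin n → ℝ))
    (U : Set (Fin m → ℝ)) (T K : Set (Fin n → ℝ)) (P : Measure (Fin n → ℝ)) :
    ℕ → (Fin n → ℝ) → ℝ
  | 0 => fun x => T.indicator (fun _ => (1 : ℝ)) x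
  | j + 1 => fun x =>
      K.indicator (fun _ => (1 : ℝ)) x *
        sSup ((fun u => ∫ w, Vstep f U T K P j (f x u + w) ∂P) '' U)

theorem integral_le_one_of_mem_Icc {α : Type*} [MeasurableSpace α] {P : Measure α}
    [IsProbabilityMeasure P] {g : α → ℝ} (hg : ∀ a, g a ∈ Set.Icc (0 : ℝ) 1) :
    ∫ a, g a ∂P ≤ 1 := by
  have h := norm_integral_le_of_norm_le_const (μ := P) (C := 1) (f := g)
    (Filter.Eventually.of_forall fun a => by
      rw [Real.norm_of_nonneg (hg a).1]
      exact (hg a).2)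
  simpa using (Real.le_norm_self _).trans h

theorem Vstep_mem_Icc {n m : ℕ} (f : (Fin n → ℝ) → (Fin m → ℝ) → (Fin n → ℝ))
    (U : Set (Fin m → ℝ)) (T K : Set (Fin n → ℝ)) (P : Measure (Fin n → ℝ))
    [IsProbabilityMeasure P] (j : ℕ) (x : Fin n → ℝ) :
    Vstep f U T K P j x ∈ Set.Icc (0 : ℝ) 1 := by
  induction j generalizing x with
  | zero =>
    rw [Vstep]
    by_cases hx : x ∈ T <;> simp [hx]
  | succ j ih =>
    rw [Vstep]
    have h0 : 0 ≤ sSup ((fun u => ∫ w, Vstep f U T K P j (f x u + w) ∂P) '' U) := by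
      apply Real.sSup_nonneg
      rintro _ ⟨u, -, rfl⟩
      exact integral_nonneg fun w => (ih _).1
    have h1 : sSup ((fun u => ∫ w, Vstep f U T K P j (f x u + w) ∂P) '' U) ≤ 1 := by
      apply Real.sSup_le _ zero_le_one
      rintro _ ⟨u, -, rfl⟩
      exact integral_le_one_of_mem_Icc fun w => ih _
    by_cases hx : x ∈ K <;> simp [hx, h0, h1]

theorem traj_cons {n m : ℕ} (f : (Fin n → ℝ) → (Fin m → ℝ) → (Fin n → ℝ))
    (ν : ℕ → (Fin n → ℝ) → (Fin m → ℝ)) (w : ℕ → (Fin n → ℝ)) (x d : Fin n → ℝ) (k : ℕ) :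
    traj f ν (fun i => Nat.casesOn i d w) x (k + 1) =
      traj f (fun i => ν (i + 1)) w (f x (ν 0 x) + d) k := by
  induction k with
  | zero => rfl
  | succ k ih => rw [traj, ih]; rfl

theorem exists_control_of_mem_RA_succ {n m : ℕ} {f : (Fin n → ℝ) → (Fin m → ℝ) → (Fin n → ℝ)}
    {U : Set (Fin m → ℝ)} {T K D : Set (Fin n → ℝ)} (hD : D.Nonempty) {t : ℕ} {x : Fin n → ℝ}
    (hx : x ∈ RA f U T K D (t + 1)) :
    x ∈ K ∧ ∃ u ∈ U, ∀ d ∈ D, f x u + d ∈ RA f U T K D t := by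
  obtain ⟨ν, hν, h⟩ := hx
  obtain ⟨d₀, hd₀⟩ := hD
  refine ⟨(h (fun _ => d₀) fun _ _ => hd₀).1 0 t.succ_pos, ν 0 x, hν 0 t.succ_pos x, ?_⟩
  intro d hd
  refine ⟨fun i => ν (i + 1), fun k hk => hν (k + 1) (by omega), fun w hw => ?_⟩
  obtain ⟨hK, hT⟩ := h (fun i => Nat.casesOn i d w) (by
    rintro (_ | k) hk
    · exact hd
    · exact hw k (by omega))
  refine ⟨fun k hk => ?_, ?_⟩
  · rw [← traj_cons]
    exact hK (k + 1) (by omega)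
  · rw [← traj_cons]
    exact hT

theorem measureReal_pow_le_Vstep {n m : ℕ} {f : (Fin n → ℝ) → (Fin m → ℝ) → (Fin n → ℝ)}
    {U : Set (Fin m → ℝ)} {T K D : Set (Fin n → ℝ)} {P : Measure (Fin n → ℝ)}
    [IsProbabilityMeasure P] (hD : D.Nonempty) (hDm : MeasurableSet D) {t : ℕ}
    (hV : ∀ j, j < t → Measurable (Vstep f U T K P j)) {x : Fin n → ℝ}
    (hx : x ∈ RA f U T K D t) : P.real D ^ t ≤ Vstep f U T K P t x := by
  induction t generalizing x with
  | zero =>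
    obtain ⟨ν, -, h⟩ := hx
    have hxT : x ∈ T := (h (fun _ => 0) (by simp)).2
    simp [Vstep, hxT]
  | succ t ih =>
    obtain ⟨hxK, u, hu, hstep⟩ := exists_control_of_mem_RA_succ hD hx
    have ih' := fun d hd => ih (fun j hj => hV j (by omega)) (hstep d hd)
    have hint : Integrable (fun w => Vstep f U T K P t (f x u + w)) P := by
      refine Integrable.of_mem_Icc 0 1
        ((hV t t.lt_succ_self).comp (measurable_const_add _)).aemeasurable ?_
      exact Filter.Eventually.of_forall fun w => Vstep_mem_Icc f U T K P t _
    have hle : P.real D ^ (t + 1) ≤ ∫ w, Vstep f U T K P t (f x u + w) ∂P := by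
      calc P.real D ^ (t + 1) = ∫ w, D.indicator (fun _ => P.real D ^ t) w ∂P := by
            rw [integral_indicator_const _ hDm, smul_eq_mul, pow_succ']
        _ ≤ _ := by
            refine integral_mono ((integrable_const _).indicator hDm) hint fun w => ?_
            by_cases hw : w ∈ D
            · simpa [hw] using ih' w hw
            · simpa [hw] using (Vstep_mem_Icc f U T K P t _).1
    have hbdd : BddAbove ((fun u => ∫ w, Vstep f U T K P t (f x u + w) ∂P) '' U) := by
      refine ⟨1, ?_⟩
      rintro _ ⟨u, -, rfl⟩
      exact integral_le_one_of_mem_Icc fun w => Vstep_mem_Icc f U T K P t _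
    simp only [Vstep, Set.indicator_of_mem hxK, one_mul]
    exact hle.trans (le_csSup hbdd ⟨u, hu, rfl⟩)

/-- if `P(𝒟) = β^{1/t}`, then the `t`-step robust reach-avoid set
underapproximates the stochastic reach-avoid `β`-level-set
`L_t(β) = { x : V_{N-t}(x) ≥ β }`, where `V_{N-t} = Vstep t`. -/
theorem robust_reach_avoid_underapproximates_stochastic_level_set {n m : ℕ}
    (f : (Fin n → ℝ) → (Fin m → ℝ) → (Fin n → ℝ)) (U : Set (Fin m → ℝ))
    (T K D : Set (Fin n → ℝ))
    (hK : MeasurableSet K) (hT : MeasurableSet T) (hU : U.Nonempty)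
    (hf : Measurable fun p : (Fin n → ℝ) × (Fin m → ℝ) => f p.1 p.2)
    (P : Measure (Fin n → ℝ)) [IsProbabilityMeasure P]
    (N : ℕ) (hV : ∀ j, j ≤ N → Measurable (Vstep f U T K P j))
    (β : ℝ) (hβ0 : 0 ≤ β) (hβ1 : β ≤ 1)
    (t : ℕ) (ht : 1 ≤ t) (htN : t ≤ N)
    (hD : D.Nonempty) (hDm : MeasurableSet D)
    (hPD : P D = ENNReal.ofReal (β ^ (1 / (t : ℝ)))) :
    RA f U T K D t ⊆ {x : Fin n → ℝ | β ≤ Vstep f U T K P t x} := by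
  intro x hx
  have h := measureReal_pow_le_Vstep hD hDm (fun j hj => hV j (hj.le.trans htN)) hx
  rwa [Measure.real, hPD, ENNReal.toReal_ofReal (Real.rpow_nonneg hβ0 _), one_div,
    Real.rpow_inv_natCast_pow hβ0 (by omega)] at h
end
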